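/- Let K be a compact Hausdorff space, let n ∈ ℕ, n ≥ 1, let p₁, …, pₙ be positive real numbers and p = p₁ + ⋯ + pₙ. Define μ : C(K)ⁿ → C(K) by μ(x₁, …, xₙ)(t) = ∏_{i=1}^n sign(xᵢ(t))·|xᵢ(t)|^{pᵢ/p}, and for q > 0 and x ∈ C(K) define ‖x‖_{(q)} = inf { Σ_{i=1}^k ‖vᵢ‖_∞^q : k ∈ ℕ, v₁, …, v_k ∈ C(K), vᵢ ≥ 0, and |x(t)|^q ≤ Σ_{i=1}^k vᵢ(t)^q for all t ∈ K }. Then for all x₁, …, xₙ ∈ C(K) one has ‖μ(x₁, …, xₙ)‖_{(p)} ≤ ‖x₁‖_{(p₁)} · ‖x₂‖_{(p₂)} ⋯ ‖xₙ‖_{(pₙ)}. -/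

import Mathlib

/-- The seminorm `‖x‖_{(q)}` of the `q`-concavification of `C(K)`:
the infimum of `Σᵢ ‖vᵢ‖_∞^q` over all finite families `v₁, …, v_k ≥ 0` in
`C(K)` with `|x| ≤ v₁ ⊕ ⋯ ⊕ v_k`, i.e. `|x(t)|^q ≤ Σᵢ vᵢ(t)^q` for all `t`. -/
noncomputable def concSeminorm {K : Type*} [TopologicalSpace K] [CompactSpace K]
    (q : ℝ) (x : C(K, ℝ)) : ℝ :=
  sInf { r : ℝ | ∃ (k : ℕ) (v : Fin k → C(K, ℝ)),
    (∀ i, 0 ≤ v i) ∧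
    (∀ t : K, |x t| ^ q ≤ ∑ i, (v i t) ^ q) ∧
    r = ∑ i, ‖v i‖ ^ q }

theorem concSeminorm_eq_aux {K : Type*} [TopologicalSpace K] [CompactSpace K]
    (q : ℝ) (hq : 0 < q) (x : C(K, ℝ)) : concSeminorm q x = ‖x‖ ^ q := by
  unfold concSeminorm
  apply IsLeast.csInf_eq
  constructor
  · refine ⟨1, fun _ => |x|, fun _ => abs_nonneg x, fun t => ?_, ?_⟩
    · simp
    · simp [ContinuousMap.norm_eq_iSup_norm]
  · rintro r ⟨k, v, hv, hx, rfl⟩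
    have hr : 0 ≤ ∑ i, ‖v i‖ ^ q := Finset.sum_nonneg fun i _ => by positivity
    have h : ‖x‖ ≤ (∑ i, ‖v i‖ ^ q) ^ q⁻¹ := by
      rw [ContinuousMap.norm_le _ (by positivity)]
      intro t
      rw [Real.norm_eq_abs, Real.le_rpow_inv_iff_of_pos (abs_nonneg _) hr hq]
      refine (hx t).trans (Finset.sum_le_sum fun i _ => ?_)
      exact Real.rpow_le_rpow (hv i t) ((le_abs_self _).trans ((v i).norm_coe_le_norm t)) hq.le
    rwa [Real.le_rpow_inv_iff_of_pos (norm_nonneg _) hr hq] at h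

/-- Let `K` be a compact Hausdorff space, `n ≥ 1`,
`p₁, …, pₙ > 0`, `p = p₁ + ⋯ + pₙ`, and let `μ : C(K)ⁿ → C(K)` be the weighted
geometric-mean map `μ(x₁, …, xₙ)(t) = ∏ᵢ sign(xᵢ(t))·|xᵢ(t)|^{pᵢ/p}`.  Then
`‖μ(x₁, …, xₙ)‖_{(p)} ≤ ‖x₁‖_{(p₁)} ⋯ ‖xₙ‖_{(pₙ)}`. -/
theorem fremlin_stmt9
    {K : Type*} [TopologicalSpace K] [CompactSpace K] [T2Space K]
    {n : ℕ} (hn : 0 < n)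
    (p : Fin n → ℝ) (hp : ∀ i, 0 < p i)
    (x : Fin n → C(K, ℝ)) (m : C(K, ℝ))
    (hm : ∀ t : K, m t = ∏ i, Real.sign (x i t) * |x i t| ^ (p i / ∑ j, p j)) :
    concSeminorm (∑ j, p j) m ≤ ∏ i, concSeminorm (p i) (x i) := by
  have hP : 0 < ∑ j, p j :=
    Finset.sum_pos (fun i _ => hp i) ⟨⟨0, hn⟩, Finset.mem_univ _⟩
  rw [concSeminorm_eq_aux _ hP]
  simp_rw [fun i => concSeminorm_eq_aux (p i) (hp i) (x i)]
  have h0 : 0 ≤ ∏ i, ‖x i‖ ^ p i := Finset.prod_nonneg fun i _ => by positivity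
  rw [← Real.le_rpow_inv_iff_of_pos (norm_nonneg _) h0 hP,
    ContinuousMap.norm_le _ (by positivity)]
  intro t
  rw [hm t, norm_prod, ← Real.finsetProd_rpow _ _ (fun i _ => by positivity)]
  refine Finset.prod_le_prod (fun i _ => norm_nonneg _) fun i _ => ?_
  rw [← Real.rpow_mul (norm_nonneg _), ← div_eq_mul_inv, norm_mul,
    Real.norm_of_nonneg (Real.rpow_nonneg (abs_nonneg (x i t)) _)]
  have hs : ‖Real.sign (x i t)‖ ≤ 1 := by
    rcases Real.sign_apply_eq (x i t) with h | h | h <;> simp [h]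
  calc _ ≤ 1 * |x i t| ^ (p i / ∑ j, p j) := by gcongr
    _ ≤ _ := by
      rw [one_mul]
      exact Real.rpow_le_rpow (abs_nonneg _) ((x i).norm_coe_le_norm t)
        (div_nonneg (hp i).le hP.le)
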